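/- Let v ∈ T₁^∘ have size p, let ⃗t = (t₁, …, t_p) be a sequence of terms of T₁^*, let γ ∈ B_•, and set t = v[⃗t]. Then the evaluation of t at γ in (B_•, *, ∘) satisfies t(γ) = t₁(γ) · ∂(t₂(γ)) · ∂²(t₃(γ)) · ⋯ · ∂^{p−1}(t_p(γ)) · v(1), where each t_i(γ) denotes the evaluation of t_i at γ in (B_•, *). -/

import Mathlib

namespace ParenBraid

/-- Generators of the parenthesized braid group: `Sum.inl i` stands for `σ_{i+1}` and
`Sum.inr i` stands for `a_{i+1}` (so the index `i : ℕ` ranges over `0, 1, 2, …`,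
representing the indices `1, 2, 3, …` of the paper). -/
abbrev Gen : Type := ℕ ⊕ ℕ

/-- The free-group generator `σ_{i+1}`. -/
def sg (i : ℕ) : FreeGroup Gen := FreeGroup.of (Sum.inl i)

/-- The free-group generator `a_{i+1}`. -/
def ag (i : ℕ) : FreeGroup Gen := FreeGroup.of (Sum.inr i)

/-- The defining relations of the parenthesized braid group `B_•`, written as words
`lhs * rhs⁻¹`:  `σ_jσ_i = σ_iσ_j` and `a_jσ_i = σ_i a_j` for `j ≥ i+2`;
`a_jσ_i = σ_{i+1} a_j` and `a_j a_i = a_{i+1} a_j` for `j ≤ i−1`; and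
`σ_{i+1}σ_iσ_{i+1} = σ_iσ_{i+1}σ_i`, `σ_iσ_{i+1} a_i = a_{i+1}σ_i`,
`σ_{i+1}σ_i a_{i+1} = a_iσ_i` for all `i ≥ 1`. -/
def rels : Set (FreeGroup Gen) :=
  {r | (∃ i j : ℕ, j ≥ i + 2 ∧ r = sg j * sg i * (sg i * sg j)⁻¹) ∨
       (∃ i j : ℕ, j ≥ i + 2 ∧ r = ag j * sg i * (sg i * ag j)⁻¹) ∨
       (∃ i j : ℕ, j < i ∧ r = ag j * sg i * (sg (i + 1) * ag j)⁻¹) ∨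
       (∃ i j : ℕ, j < i ∧ r = ag j * ag i * (ag (i + 1) * ag j)⁻¹) ∨
       (∃ i : ℕ, r = sg (i + 1) * sg i * sg (i + 1) * (sg i * sg (i + 1) * sg i)⁻¹) ∨
       (∃ i : ℕ, r = sg i * sg (i + 1) * ag i * (ag (i + 1) * sg i)⁻¹) ∨
       (∃ i : ℕ, r = sg (i + 1) * sg i * ag (i + 1) * (ag i * sg i)⁻¹)}

/-- The parenthesized braid group `B_•`. -/
def Bdot : Type := PresentedGroup rels

instance : Group Bdot := by unfold Bdot; infer_instance

/-- The generator `σ_{i+1}` of `B_•`. -/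
def σ (i : ℕ) : Bdot := PresentedGroup.of (Sum.inl i)

/-- The generator `a_{i+1}` of `B_•`. -/
def a (i : ℕ) : Bdot := PresentedGroup.of (Sum.inr i)


/-- Terms in a single variable over the single operation symbol `∘`. -/
inductive CTerm : Type
  | var : CTerm
  | circ : CTerm → CTerm → CTerm

/-- Terms in a single variable over the single operation symbol `*`. -/
inductive STerm1 : Type
  | var : STerm1
  | star : STerm1 → STerm1 → STerm1

/-- Terms in a single variable over the two operation symbols `*` and `∘`. -/
inductive Term1 : Type
  | var : Term1
  | star : Term1 → Term1 → Term1
  | circ : Term1 → Term1 → Term1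

/-- The canonical embedding of `*`-terms into `{*,∘}`-terms. -/
def STerm1.toTerm1 : STerm1 → Term1
  | .var => .var
  | .star u v => .star u.toTerm1 v.toTerm1

/-- `Subst v ⃗t t` means `t = v[⃗t]`: `t` is obtained from `v` by substituting the
entries of `⃗t` for the successive variable occurrences of `v` from left to right. -/
inductive Subst : CTerm → List STerm1 → Term1 → Prop
  | var (s : STerm1) : Subst .var [s] s.toTerm1
  | circ {u v : CTerm} {ss ts : List STerm1} {t₁ t₂ : Term1} :
      Subst u ss t₁ → Subst v ts t₂ → Subst (.circ u v) (ss ++ ts) (.circ t₁ t₂)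

/-- The evaluation `v(1)` of a `∘`-term `v` in `(B_•, ∘)`, with every variable
occurrence assigned the identity `1`, where `β ∘ γ := β·∂γ·a₁`. -/
def evalC (D : Bdot →* Bdot) : CTerm → Bdot
  | .var => 1
  | .circ u v => evalC D u * D (evalC D v) * a 0

/-- The evaluation `s(γ)` of a `*`-term `s` at `γ` in `(B_•, *)`, where
`β * γ := β·∂γ·σ₁·(∂β)⁻¹`. -/
def evalS (D : Bdot →* Bdot) (γ : Bdot) : STerm1 → Bdot
  | .var => γ
  | .star u v => evalS D γ u * D (evalS D γ v) * σ 0 * (D (evalS D γ u))⁻¹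

/-- The evaluation `t(γ)` of a `{*,∘}`-term `t` at `γ` in `(B_•, *, ∘)`. -/
def evalT (D : Bdot →* Bdot) (γ : Bdot) : Term1 → Bdot
  | .var => γ
  | .star u v => evalT D γ u * D (evalT D γ v) * σ 0 * (D (evalT D γ u))⁻¹
  | .circ u v => evalT D γ u * D (evalT D γ v) * a 0

/-- The product `t₁(γ)·∂(t₂(γ))·∂²(t₃(γ))⋯∂^{p−1}(t_p(γ))` associated with a
sequence `(t₁, …, t_p)` of `*`-terms. -/
def prodShift (D : Bdot →* Bdot) (γ : Bdot) : List STerm1 → Bdot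
  | [] => 1
  | t :: ts => evalS D γ t * D (prodShift D γ ts)

theorem eq_of_mul_inv_mem_rels {x y : FreeGroup Gen} (h : x * y⁻¹ ∈ rels) :
    (PresentedGroup.mk rels x : Bdot) = PresentedGroup.mk rels y := by
  have h₁ := PresentedGroup.one_of_mem h
  rw [map_mul, map_inv, mul_inv_eq_one] at h₁
  exact h₁

theorem a_mul_σ {i j : ℕ} (h : j < i) : a j * σ i = σ (i + 1) * a j :=
  eq_of_mul_inv_mem_rels (x := ag j * sg i) (y := sg (i + 1) * ag j)
    (Or.inr (Or.inr (Or.inl ⟨i, j, h, rfl⟩)))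

theorem a_mul_a {i j : ℕ} (h : j < i) : a j * a i = a (i + 1) * a j :=
  eq_of_mul_inv_mem_rels (x := ag j * ag i) (y := ag (i + 1) * ag j)
    (Or.inr (Or.inr (Or.inr (Or.inl ⟨i, j, h, rfl⟩))))

theorem hom_ext {G : Type*} [Group G] {f g : Bdot →* G}
    (hσ : ∀ i, f (σ i) = g (σ i)) (ha : ∀ i, f (a i) = g (a i)) : f = g := by
  refine PresentedGroup.ext (rels := rels) (φ := f) (ψ := g) ?_
  rintro (i | i)
  exacts [hσ i, ha i]

/-- Conjugation by `a₁` acts on the image of the shift as the shift itself. -/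
theorem a_zero_mul_shift (D : Bdot →* Bdot)
    (hDσ : ∀ i : ℕ, D (σ i) = σ (i + 1)) (hDa : ∀ i : ℕ, D (a i) = a (i + 1))
    (β : Bdot) : a 0 * D β = D (D β) * a 0 := by
  have h : (MulAut.conj (a 0)).toMonoidHom.comp D = D.comp D := by
    apply hom_ext <;> intro i
    · simp [hDσ, a_mul_σ i.succ_pos]
    · simp [hDa, a_mul_a i.succ_pos]
  simpa [mul_inv_eq_iff_eq_mul] using DFunLike.congr_fun h β

theorem evalC_mul_shift (D : Bdot →* Bdot)
    (hDσ : ∀ i : ℕ, D (σ i) = σ (i + 1)) (hDa : ∀ i : ℕ, D (a i) = a (i + 1))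
    {v : CTerm} {ts : List STerm1} {t : Term1} (h : Subst v ts t) (β : Bdot) :
    evalC D v * D β = D^[ts.length] β * evalC D v := by
  induction h generalizing β with
  | var s => simp [evalC]
  | @circ u v ss ts t₁ t₂ _ _ ihu ihv =>
    calc evalC D u * D (evalC D v) * a 0 * D β
        = evalC D u * D (evalC D v * D β) * a 0 := by
          rw [mul_assoc, a_zero_mul_shift D hDσ hDa, map_mul]
          simp only [mul_assoc]
      _ = evalC D u * D (D^[ts.length] β) * (D (evalC D v) * a 0) := by
          rw [ihv, map_mul]
          simp only [mul_assoc]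
      _ = D^[(ss ++ ts).length] β * (evalC D u * D (evalC D v) * a 0) := by
          rw [ihu, List.length_append, Function.iterate_add_apply]
          simp only [mul_assoc]

theorem prodShift_append (D : Bdot →* Bdot) (γ : Bdot) (ss ts : List STerm1) :
    prodShift D γ (ss ++ ts) = prodShift D γ ss * D^[ss.length] (prodShift D γ ts) := by
  induction ss with
  | nil => simp [prodShift]
  | cons s ss ih =>
    simp [prodShift, ih, mul_assoc, Function.iterate_succ_apply', -Function.iterate_succ]

theorem evalT_toTerm1 (D : Bdot →* Bdot) (γ : Bdot) (s : STerm1) :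
    evalT D γ s.toTerm1 = evalS D γ s := by
  induction s with
  | var => rfl
  | star u v ihu ihv => simp only [STerm1.toTerm1, evalT, evalS, ihu, ihv]

/-- if `t = v[⃗t]` with `v` a `∘`-term of size `p` and `⃗t = (t₁, …, t_p)`
a sequence of `*`-terms, then `t(γ) = t₁(γ)·∂(t₂(γ))·⋯·∂^{p−1}(t_p(γ))·v(1)`. -/
theorem evalT_subst (D : Bdot →* Bdot)
    (hDσ : ∀ i : ℕ, D (σ i) = σ (i + 1)) (hDa : ∀ i : ℕ, D (a i) = a (i + 1))
    (v : CTerm) (ts : List STerm1) (γ : Bdot) (t : Term1)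
    (h : Subst v ts t) :
    evalT D γ t = prodShift D γ ts * evalC D v := by
  induction h with
  | var s => simp [evalT_toTerm1, prodShift, evalC]
  | @circ u v ss ts t₁ t₂ hu _ ihu ihv =>
    rw [evalT, evalC, ihu, ihv, prodShift_append, map_mul]
    have h := evalC_mul_shift D hDσ hDa hu (prodShift D γ ts)
    calc prodShift D γ ss * evalC D u * (D (prodShift D γ ts) * D (evalC D v)) * a 0
        = prodShift D γ ss * (evalC D u * D (prodShift D γ ts)) * (D (evalC D v) * a 0) := by
          simp only [mul_assoc]
      _ = _ := by
          rw [h]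
          simp only [mul_assoc]

end ParenBraid
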